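/- Let 0<δ<1/2. There exist constants x>0 and C_δ>0 such that for every C¹ function h on [0,∞) with ‖h'‖_{L^{∞,2-δ}_r} < x, the function f(r)=exp((1/2)∫₀ʳ (h(s)-h̄(s))²/s ds) satisfies, for all r>0, |(3/r²)∫₀ʳ s² f(s) ds − r f(r)| ≤ C_δ (1+r)^{2δ-1} ‖h'‖²_{L^{∞,2-δ}_r}. -/

import Mathlib

open Set MeasureTheory Real

/-- Radial average: `w̄(r) = (1/r)∫₀ʳ w(s) ds` for `r ≠ 0`, with `w̄(0) = w(0)`. -/
noncomputable def radAvg (w : ℝ → ℝ) (r : ℝ) : ℝ :=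
  if r = 0 then w 0 else (∫ s in (0:ℝ)..r, w s) / r
/-- The metric coefficient `f(r) = exp((1/2)∫₀ʳ (h(s)-h̄(s))²/s ds)` built from `h`. -/
noncomputable def metF1 (h : ℝ → ℝ) (r : ℝ) : ℝ :=
  Real.exp (2⁻¹ * ∫ s in (0:ℝ)..r, (h s - radAvg h s) ^ 2 / s)

/-- A comparison principle on `[0, ∞)`: a bound on derivatives integrates to a bound on values. -/
theorem abs_le_of_abs_deriv_le {φ φ' B B' : ℝ → ℝ} (hφ0 : φ 0 = 0) (hB0 : B 0 = 0)
    (hφ : ∀ s, 0 ≤ s → HasDerivAt φ (φ' s) s) (hB : ∀ s, 0 ≤ s → HasDerivAt B (B' s) s)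
    (hle : ∀ s, 0 ≤ s → |φ' s| ≤ B' s) {r : ℝ} (hr : 0 ≤ r) : |φ r| ≤ B r := by
  have key := image_norm_le_of_norm_deriv_right_le_deriv_boundary' (f := φ) (f' := φ')
    (a := 0) (b := r) (B := B) (B' := B')
    (fun s hs => (hφ s hs.1).continuousAt.continuousWithinAt)
    (fun s hs => (hφ s hs.1).hasDerivWithinAt) (by simp [hφ0, hB0])
    (fun s hs => (hB s hs.1).continuousAt.continuousWithinAt)
    (fun s hs => (hB s hs.1).hasDerivWithinAt)
    (fun s hs => hle s hs.1)
  exact key ⟨hr, le_rfl⟩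

theorem hasDerivAt_one_add_rpow (p : ℝ) {s : ℝ} (hs : 0 ≤ s) :
    HasDerivAt (fun t : ℝ => (1 + t) ^ p) (p * (1 + s) ^ (p - 1)) s := by
  have h := ((hasDerivAt_id s).const_add 1).rpow_const (p := p) (Or.inl (by simp; linarith))
  simpa using h

/-- The decay of `h'` controls the deviation of `h` from its radial average. -/
theorem abs_sub_radAvg_le {δ N : ℝ} (hδ₁ : 0 < δ) (hδ₂ : δ ≤ 2) {h : ℝ → ℝ} (hh : ContDiff ℝ 1 h)
    (hN : ∀ s : ℝ, 0 ≤ s → (1 + s) ^ (2 - δ) * |deriv h s| ≤ N) {s : ℝ} (hs : 0 ≤ s) :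
    |h s - radAvg h s| ≤ N / δ * (s * (1 + s) ^ (δ - 2)) := by
  have hN0 : 0 ≤ N := le_trans (by positivity) (hN 0 le_rfl)
  rcases hs.eq_or_lt with rfl | hs'
  · simp [radAvg]
  have key : |s * h s - ∫ t in (0:ℝ)..s, h t| ≤ N / δ * (s ^ 2 * (1 + s) ^ (δ - 2)) := by
    refine abs_le_of_abs_deriv_le (φ := fun s => s * h s - ∫ t in (0:ℝ)..s, h t)
      (φ' := fun s => s * deriv h s)
      (B := fun s => N / δ * (s ^ 2 * (1 + s) ^ (δ - 2)))
      (B' := fun s => N / δ *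
        (2 * s * (1 + s) ^ (δ - 2) + s ^ 2 * ((δ - 2) * (1 + s) ^ (δ - 2 - 1))))
      (by simp) (by simp) ?_ ?_ ?_ hs
    · intro t _
      have h1 := (hh.differentiable (by norm_num) t).hasDerivAt
      have h2 := hh.continuous.integral_hasStrictDerivAt 0 t
      refine HasDerivAt.congr_deriv (((hasDerivAt_id t).mul h1).sub h2.hasDerivAt) ?_
      simp
    · intro t ht
      have h1 := (hasDerivAt_pow 2 t).mul (hasDerivAt_one_add_rpow (δ - 2) ht)
      refine HasDerivAt.congr_deriv (h1.const_mul (N / δ)) ?_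
      simp
    · intro t ht
      have h1 : 0 < 1 + t := by linarith
      have e1 : (1 + t) ^ (δ - 2) = (1 + t) ^ (δ - 2 - 1) * (1 + t) := by
        rw [← rpow_add_one h1.ne']; ring_nf
      have e2 : (1 + t) ^ (δ - 2) * (1 + t) ^ (2 - δ) = 1 := by
        rw [← rpow_add h1]; simp
      have h2 : |deriv h t| ≤ N * (1 + t) ^ (δ - 2) := by
        have := mul_le_mul_of_nonneg_left (hN t ht) (rpow_nonneg h1.le (δ - 2))
        rw [← mul_assoc, e2] at this
        linarith
      rw [abs_mul, abs_of_nonneg ht]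
      calc t * |deriv h t| ≤ t * (N * (1 + t) ^ (δ - 2)) := by gcongr
        _ = N / δ * (t * (1 + t) ^ (δ - 2 - 1) * (δ * (1 + t))) := by
          rw [e1]; field_simp
        _ ≤ N / δ * (t * (1 + t) ^ (δ - 2 - 1) * (2 + δ * t)) := by
          gcongr; linarith
        _ = _ := by rw [e1]; ring
  have e : h s - radAvg h s = (s * h s - ∫ t in (0:ℝ)..s, h t) / s := by
    rw [radAvg, if_neg hs'.ne']; field_simp
  rw [e, abs_div, abs_of_pos hs', div_le_iff₀ hs']
  linarith

theorem continuousAt_radAvg {h : ℝ → ℝ} (hh : Continuous h) {s : ℝ} (hs : s ≠ 0) :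
    ContinuousAt (radAvg h) s := by
  have h1 : ContinuousAt (fun r => (∫ t in (0:ℝ)..r, h t) / r) s :=
    (hh.integral_hasStrictDerivAt 0 s).hasDerivAt.continuousAt.div continuousAt_id hs
  refine h1.congr ?_
  filter_upwards [isOpen_ne.mem_nhds hs] with r hr
  simp [radAvg, if_neg hr]

/-- If `|w s| ≤ K s` for `s ≥ 0` and `w` is continuous on `(0, ∞)`, then `w² / s`, frozen for
negative `s`, is continuous. -/
theorem continuous_sq_div_max {w : ℝ → ℝ} {K : ℝ} (hw : ∀ s, 0 < s → ContinuousAt w s)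
    (hK : ∀ s, 0 ≤ s → |w s| ≤ K * s) :
    Continuous (fun s => w (max s 0) ^ 2 / max s 0) := by
  have hon : ContinuousOn (fun s => w s ^ 2 / s) (Ici 0) := by
    intro s hs
    rcases (mem_Ici.1 hs).eq_or_lt with rfl | hs'
    · have hlim : Filter.Tendsto (fun s : ℝ => K ^ 2 * s) (nhdsWithin 0 (Ici 0)) (nhds 0) := by
        have : Continuous (fun s : ℝ => K ^ 2 * s) := by fun_prop
        simpa using this.continuousWithinAt.tendsto (x := 0) (s := Ici 0)
      unfold ContinuousWithinAt
      simp only [div_zero]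
      refine squeeze_zero' ?_ ?_ hlim
      · filter_upwards [self_mem_nhdsWithin] with t ht
        exact div_nonneg (sq_nonneg _) ht
      · filter_upwards [self_mem_nhdsWithin] with t ht
        have ht : 0 ≤ t := ht
        refine div_le_of_le_mul₀ ht (by positivity) ?_
        calc w t ^ 2 = |w t| ^ 2 := (sq_abs _).symm
          _ ≤ (K * t) ^ 2 := by gcongr; exact hK t ht
          _ = K ^ 2 * t * t := by ring
    · exact (((hw s hs').pow 2).div continuousAt_id hs'.ne').continuousWithinAt
  exact hon.comp_continuous (by fun_prop) (fun s => le_max_right s 0)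

theorem f_moment_bound (δ : ℝ) (hδ₁ : 0 < δ) (hδ₂ : δ < 1/2) :
    ∃ x > (0:ℝ), ∃ C > (0:ℝ), ∀ h : ℝ → ℝ, ContDiff ℝ 1 h →
      ∀ N : ℝ, 0 ≤ N → N < x →
      (∀ s : ℝ, 0 ≤ s → (1 + s) ^ (2 - δ) * |deriv h s| ≤ N) →
      ∀ r : ℝ, 0 < r →
        |(3 / r ^ 2) * (∫ s in (0:ℝ)..r, s ^ 2 * metF1 h s) - r * metF1 h r| ≤
          C * (1 + r) ^ (2 * δ - 1) * N ^ 2 := by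
  refine ⟨δ, hδ₁, exp 1 / δ ^ 2, by positivity, fun h hh N hN0 hNδ hN r hr => ?_⟩
  set K := N / δ with hK
  have hK0 : 0 ≤ K := by positivity
  have hK1 : K ≤ 1 := (div_le_one hδ₁).2 hNδ.le
  have hw : ∀ s, 0 ≤ s → |h s - radAvg h s| ≤ K * (s * (1 + s) ^ (δ - 2)) :=
    fun s hs => abs_sub_radAvg_le hδ₁ (by linarith) hh hN hs
  set q : ℝ → ℝ := fun s => (h (max s 0) - radAvg h (max s 0)) ^ 2 / max s 0 with hq
  have hqc : Continuous q := by
    refine continuous_sq_div_max (w := fun s => h s - radAvg h s) (K := K)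
      (fun s hs => hh.continuous.continuousAt.sub (continuousAt_radAvg hh.continuous hs.ne'))
      (fun s hs => (hw s hs).trans ?_)
    have : (1 + s) ^ (δ - 2) ≤ 1 := rpow_le_one_of_one_le_of_nonpos (by linarith) (by linarith)
    exact mul_le_mul_of_nonneg_left (mul_le_of_le_one_right hs this) hK0
  have hq0 : ∀ s, 0 ≤ q s := fun s => div_nonneg (sq_nonneg _) (le_max_right _ _)
  have hqle : ∀ s, 0 ≤ s → q s ≤ K ^ 2 * (s * (1 + s) ^ (2 * δ - 4)) := by
    intro s hs
    have e : (1 + s) ^ (2 * δ - 4) = ((1 + s) ^ (δ - 2)) ^ 2 := by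
      rw [← rpow_natCast, ← rpow_mul (by linarith)]; push_cast; ring_nf
    simp only [hq, max_eq_left hs]
    refine div_le_of_le_mul₀ hs (by positivity) ?_
    calc (h s - radAvg h s) ^ 2 = |h s - radAvg h s| ^ 2 := (sq_abs _).symm
      _ ≤ (K * (s * (1 + s) ^ (δ - 2))) ^ 2 := by gcongr; exact hw s hs
      _ = _ := by rw [e]; ring
  set F : ℝ → ℝ := fun s => ∫ t in (0:ℝ)..s, q t with hF
  have hFd : ∀ s, HasDerivAt F (q s) s := fun s => (hqc.integral_hasStrictDerivAt 0 s).hasDerivAt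
  have hFle : ∀ s, 0 ≤ s → F s ≤ 1 := by
    intro s hs
    have := abs_le_of_abs_deriv_le (φ := F) (φ' := q) (B := fun s => 1 - (1 + s)⁻¹)
      (B' := fun s => 1 / (1 + s) ^ 2) (by simp [hF]) (by simp) (fun s _ => hFd s) ?_ ?_ hs
    · have h1 : 0 ≤ (1 + s)⁻¹ := by positivity
      have := le_abs_self (F s)
      linarith
    · intro t ht
      have h1 := (((hasDerivAt_id t).const_add 1).inv (by simp; linarith)).const_sub 1
      refine h1.congr_deriv ?_
      simp [neg_div]
    · intro t ht
      have h1 : 0 < 1 + t := by linarith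
      rw [abs_of_nonneg (hq0 t)]
      calc q t ≤ K ^ 2 * (t * (1 + t) ^ (2 * δ - 4)) := hqle t ht
        _ ≤ 1 * ((1 + t) * (1 + t) ^ (-3 : ℝ)) := by
          gcongr
          · exact pow_le_one₀ hK0 hK1
          · linarith
          · linarith
          · linarith
        _ = 1 / (1 + t) ^ 2 := by
          rw [rpow_neg h1.le]; norm_cast; field_simp
  set E : ℝ → ℝ := fun s => exp (2⁻¹ * F s) with hE
  have hEd : ∀ s, HasDerivAt E (E s * (2⁻¹ * q s)) s := fun s => ((hFd s).const_mul _).exp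
  have hEc : Continuous E := continuous_iff_continuousAt.2 fun s => (hEd s).continuousAt
  have hmet : ∀ s, 0 ≤ s → metF1 h s = E s := by
    intro s hs
    simp only [metF1, hE, hF]
    congr 2
    refine intervalIntegral.integral_congr fun t ht => ?_
    rw [uIcc_of_le hs] at ht
    simp [hq, max_eq_left ht.1]
  have hint : (∫ s in (0:ℝ)..r, s ^ 2 * metF1 h s) = ∫ s in (0:ℝ)..r, s ^ 2 * E s := by
    refine intervalIntegral.integral_congr fun t ht => ?_
    rw [uIcc_of_le hr.le] at ht
    simp [hmet t ht.1]
  have key : |3 * (∫ s in (0:ℝ)..r, s ^ 2 * E s) - r ^ 3 * E r| ≤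
      exp 1 * K ^ 2 * (r ^ 2 * (1 + r) ^ (2 * δ - 1)) := by
    refine abs_le_of_abs_deriv_le
      (φ := fun r => 3 * (∫ s in (0:ℝ)..r, s ^ 2 * E s) - r ^ 3 * E r)
      (φ' := fun s => - (s ^ 3 * (E s * (2⁻¹ * q s))))
      (B := fun r => exp 1 * K ^ 2 * (r ^ 2 * (1 + r) ^ (2 * δ - 1)))
      (B' := fun s => exp 1 * K ^ 2 *
        (2 * s * (1 + s) ^ (2 * δ - 1) + s ^ 2 * ((2 * δ - 1) * (1 + s) ^ (2 * δ - 1 - 1))))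
      (by simp) (by simp) ?_ ?_ ?_ hr.le
    · intro t _
      have hc : Continuous (fun s : ℝ => s ^ 2 * E s) := by fun_prop
      have h2 := (hc.integral_hasStrictDerivAt 0 t).hasDerivAt.const_mul 3
      refine HasDerivAt.congr_deriv (h2.sub ((hasDerivAt_pow 3 t).mul (hEd t))) ?_
      push_cast
      ring
    · intro t ht
      have h1 := (hasDerivAt_pow 2 t).mul (hasDerivAt_one_add_rpow (2 * δ - 1) ht)
      refine HasDerivAt.congr_deriv (h1.const_mul (exp 1 * K ^ 2)) ?_
      simp
    · intro t ht
      have h1 : 0 < 1 + t := by linarith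
      have hE1 : E t ≤ exp 1 := exp_le_exp.2 (by linarith [hFle t ht])
      have hE0 : 0 ≤ E t := (exp_pos _).le
      have hqt := hq0 t
      have e1 : (1 + t) ^ (2 * δ - 1) = (1 + t) ^ (2 * δ - 1 - 1) * (1 + t) := by
        rw [← rpow_add_one h1.ne']; ring_nf
      have e2 : (1 + t) ^ (2 * δ - 1) = (1 + t) ^ (2 * δ - 4) * (1 + t) ^ 3 := by
        rw [← rpow_natCast, ← rpow_add h1]; push_cast; ring_nf
      rw [abs_neg, abs_of_nonneg (by positivity)]
      calc t ^ 3 * (E t * (2⁻¹ * q t))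
          ≤ t ^ 3 * (exp 1 * (1 * (K ^ 2 * (t * (1 + t) ^ (2 * δ - 4))))) := by
            gcongr
            · norm_num
            · exact hqle t ht
        _ = exp 1 * K ^ 2 * (t * ((1 + t) ^ (2 * δ - 4) * t ^ 3)) := by ring
        _ ≤ exp 1 * K ^ 2 * (t * ((1 + t) ^ (2 * δ - 4) * (1 + t) ^ 3)) := by
            gcongr; linarith
        _ = exp 1 * K ^ 2 * (t * (1 + t) ^ (2 * δ - 1 - 1) * (1 + t)) := by
            rw [← e2, e1]; ring
        _ ≤ exp 1 * K ^ 2 * (t * (1 + t) ^ (2 * δ - 1 - 1) * (2 * (1 + t) + (2 * δ - 1) * t)) := by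
            refine mul_le_mul_of_nonneg_left ?_ (by positivity)
            refine mul_le_mul_of_nonneg_left ?_ (by positivity)
            nlinarith
        _ = _ := by rw [e1]; ring
  rw [hint, hmet r hr.le]
  have e : (3 / r ^ 2) * (∫ s in (0:ℝ)..r, s ^ 2 * E s) - r * E r =
      (3 * (∫ s in (0:ℝ)..r, s ^ 2 * E s) - r ^ 3 * E r) / r ^ 2 := by
    field_simp
  rw [e, abs_div, abs_of_pos (pow_pos hr 2), div_le_iff₀ (pow_pos hr 2)]
  refine key.trans_eq ?_
  rw [hK]
  field_simp
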